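/- Let Ω = (−L, L) × (−1, 1) with L > 1, and let v_μ ∈ BV(∂Ω) be defined by v_μ(x₁, 1) = x₁ + L for x₁ ∈ (−L, L), v_μ(x₁, −1) = 0, v_μ(−L, x₂) = 0, and v_μ(L, x₂) = μ for x₂ ∈ (−1,1). If μ > 2L or μ < 2L (in particular whenever μ ≠ 2L in the cases where the range gap (min(2L,μ), max(2L,μ)) is nonempty and v_μ attains no value in it near the corner points (L, ±1) appropriately), then there is no u ∈ BV(Ω) of least gradient with trace Tu = v_μ. Specifically: for μ > 2L no least gradient function u with Tu = v_μ exists. -/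

import Mathlib

open MeasureTheory Metric Set Filter Topology

noncomputable section

abbrev Plane := EuclideanSpace ℝ (Fin 2)

/-- The divergence of a vector field on the plane. -/
def divg (φ : Plane → Plane) (x : Plane) : ℝ :=
  fderiv ℝ φ x (EuclideanSpace.single 0 1) 0 +
    fderiv ℝ φ x (EuclideanSpace.single 1 1) 1

/-- The set of test values defining the total variation of `u` on `Ω`:
`∫_Ω u div φ` over `C¹` vector fields `φ` compactly supported in `Ω` with
`‖φ‖ ≤ 1`. -/
def TVtest (Ω : Set Plane) (u : Plane → ℝ) : Set ℝ :=
  {r | ∃ φ : Plane → Plane, ContDiff ℝ 1 φ ∧ HasCompactSupport φ ∧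
      tsupport φ ⊆ Ω ∧ (∀ x, ‖φ x‖ ≤ 1) ∧ r = ∫ x in Ω, u x * divg φ x}

/-- `u` has bounded variation on `Ω`. -/
def BVOn (u : Plane → ℝ) (Ω : Set Plane) : Prop :=
  IntegrableOn u Ω volume ∧ BddAbove (TVtest Ω u)

/-- The total variation `∫_Ω |Du|`. -/
def totalVar (Ω : Set Plane) (u : Plane → ℝ) : ℝ :=
  sSup (TVtest Ω u)

/-- `u` is a function of least gradient on `Ω`: its total variation does not
exceed that of any compactly supported BV perturbation. -/
def LeastGradientOn (u : Plane → ℝ) (Ω : Set Plane) : Prop :=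
  BVOn u Ω ∧ ∀ φ : Plane → ℝ, BVOn φ Ω → HasCompactSupport φ →
    tsupport φ ⊆ Ω → totalVar Ω u ≤ totalVar Ω (u + φ)

/-- `u` attains the boundary datum `f` in the (continuous-limit) trace sense. -/
def HasTraceOn (u : Plane → ℝ) (Ω : Set Plane) (f : Plane → ℝ) : Prop :=
  ∀ p ∈ frontier Ω, Tendsto u (𝓝[Ω] p) (𝓝 (f p))

/-- The point `(a, b)` of the plane. -/
def pt (a b : ℝ) : Plane := (WithLp.equiv 2 (Fin 2 → ℝ)).symm ![a, b]

/-- The trace of `u` on the boundary of the rectangle `(−L,L) × (−1,1)` equals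
`f`, in the sense of a.e. one-sided limits along coordinate lines. -/
def RectTrace (L : ℝ) (u f : Plane → ℝ) : Prop :=
  (∀ᵐ x₂ ∂(volume.restrict (Set.Ioo (-1 : ℝ) 1)),
     Tendsto (fun x₁ => u (pt x₁ x₂)) (𝓝[<] L) (𝓝 (f (pt L x₂))) ∧
     Tendsto (fun x₁ => u (pt x₁ x₂)) (𝓝[>] (-L)) (𝓝 (f (pt (-L) x₂)))) ∧
  (∀ᵐ x₁ ∂(volume.restrict (Set.Ioo (-L : ℝ) L)),
     Tendsto (fun x₂ => u (pt x₁ x₂)) (𝓝[<] 1) (𝓝 (f (pt x₁ 1))) ∧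
     Tendsto (fun x₂ => u (pt x₁ x₂)) (𝓝[>] (-1)) (𝓝 (f (pt x₁ (-1)))))

section Divergence

abbrev e₀ : Plane := EuclideanSpace.single 0 1
abbrev e₁ : Plane := EuclideanSpace.single 1 1

lemma eq_coord_combination (v : Plane) : v = v 0 • e₀ + v 1 • e₁ := by
  ext i
  fin_cases i <;> simp

lemma fderiv_coord {φ : Plane → Plane} {x : Plane} (h : DifferentiableAt ℝ φ x) (v : Plane)
    (i : Fin 2) : fderiv ℝ φ x v i = fderiv ℝ (fun y => φ y i) x v := by
  have := ((EuclideanSpace.proj (𝕜 := ℝ) i).hasFDerivAt.comp x h.hasFDerivAt).fderiv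
  have h2 : (fun y => φ y i) = (EuclideanSpace.proj (𝕜 := ℝ) i) ∘ φ := rfl
  rw [h2, this]
  rfl

lemma divg_eq {φ : Plane → Plane} {x : Plane} (h : DifferentiableAt ℝ φ x) :
    divg φ x = fderiv ℝ (fun y => φ y 0) x e₀ + fderiv ℝ (fun y => φ y 1) x e₁ := by
  rw [divg, fderiv_coord h, fderiv_coord h]

lemma divg_add {φ ψ : Plane → Plane} {x : Plane} (h : DifferentiableAt ℝ φ x)
    (h' : DifferentiableAt ℝ ψ x) : divg (φ + ψ) x = divg φ x + divg ψ x := by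
  simp only [divg, fderiv_add h h']
  simp
  ring

lemma divg_const_smul (c : ℝ) {φ : Plane → Plane} {x : Plane} (h : DifferentiableAt ℝ φ x) :
    divg (c • φ) x = c * divg φ x := by
  simp only [divg, fderiv_const_smul h]
  simp
  ring

lemma divg_smul {η : Plane → ℝ} {φ : Plane → Plane} {x : Plane} (hη : DifferentiableAt ℝ η x)
    (h : DifferentiableAt ℝ φ x) :
    divg (fun y => η y • φ y) x = η x * divg φ x + fderiv ℝ η x (φ x) := by
  have h2 : fderiv ℝ η x (φ x) = φ x 0 * fderiv ℝ η x e₀ + φ x 1 * fderiv ℝ η x e₁ := by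
    conv_lhs => rw [eq_coord_combination (φ x)]
    simp
  rw [h2]
  simp only [divg, fderiv_fun_smul hη h]
  simp
  ring

lemma divg_comp_add (φ : Plane → Plane) (y x : Plane) :
    divg (fun z => φ (z + y)) x = divg φ (x + y) := by
  simp only [divg, fderiv_comp_add_right]

lemma continuous_divg {φ : Plane → Plane} (h : ContDiff ℝ 1 φ) : Continuous (divg φ) := by
  have := h.continuous_fderiv (by simp)
  unfold divg
  fun_prop

lemma divg_eq_zero {φ : Plane → Plane} {x : Plane} (h : x ∉ tsupport φ) : divg φ x = 0 := by
  have : fderiv ℝ φ x = 0 := by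
    by_contra h'
    exact h (support_fderiv_subset ℝ h')
  simp [divg, this]

lemma hasCompactSupport_divg {φ : Plane → Plane} (h : HasCompactSupport φ) :
    HasCompactSupport (divg φ) :=
  h.mono' fun x hx => by
    by_contra h'
    exact hx (divg_eq_zero h')

lemma integral_mul_divg {g : Plane → ℝ} {ψ : Plane → Plane} (hg : ContDiff ℝ 1 g)
    (hψ : ContDiff ℝ 1 ψ) (hc : HasCompactSupport ψ) :
    ∫ x, g x * divg ψ x = -∫ x, fderiv ℝ g x (ψ x) := by
  have hψd := hψ.differentiable (by simp)
  have hgd := hg.differentiable (by simp)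
  have hg' := hg.continuous_fderiv (by simp)
  have hcoord (i : Fin 2) : ContDiff ℝ 1 fun y => ψ y i := contDiff_euclidean.1 hψ i
  have hcc (i : Fin 2) : HasCompactSupport fun y => ψ y i :=
    hc.comp_left (g := fun v : Plane => v i) rfl
  have i1 (i : Fin 2) (v : Plane) :
      Integrable fun x => g x * fderiv ℝ (fun y => ψ y i) x v := by
    have h1 := (hcoord i).continuous_fderiv (by simp)
    have h2 := hg.continuous
    refine Continuous.integrable_of_hasCompactSupport (by fun_prop) ?_
    exact ((hcc i).fderiv_apply ℝ v).mul_left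
  have i2 (i : Fin 2) (v : Plane) : Integrable fun x => fderiv ℝ g x v * ψ x i := by
    have h1 := (hcoord i).continuous
    refine Continuous.integrable_of_hasCompactSupport (by fun_prop) ?_
    exact (hcc i).mul_left
  have i3 (i : Fin 2) : Integrable fun x => g x * ψ x i := by
    have h1 := (hcoord i).continuous
    have h2 := hg.continuous
    refine Continuous.integrable_of_hasCompactSupport (by fun_prop) ?_
    exact (hcc i).mul_left
  have ibp (i : Fin 2) (v : Plane) := integral_mul_fderiv_eq_neg_fderiv_mul_of_integrable
    (i2 i v) (i1 i v) (i3 i) (fun x _ => hgd x)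
    (fun x _ => (hcoord i).differentiable (by simp) x)
  calc ∫ x, g x * divg ψ x
      = ∫ x, (g x * fderiv ℝ (fun y => ψ y 0) x e₀ + g x * fderiv ℝ (fun y => ψ y 1) x e₁) := by
        congr with x
        rw [divg_eq (hψd x)]
        ring
    _ = -(∫ x, (fderiv ℝ g x e₀ * ψ x 0 + fderiv ℝ g x e₁ * ψ x 1)) := by
        rw [integral_add (i1 _ _) (i1 _ _), integral_add (i2 _ _) (i2 _ _), ibp, ibp]
        ring
    _ = _ := by
        congr with x
        conv_rhs => rw [eq_coord_combination (ψ x)]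
        simp
        ring

end Divergence

/-- Admissible test fields in the definition of the total variation. -/
structure IsTestField (Ω : Set Plane) (φ : Plane → Plane) : Prop where
  contDiff : ContDiff ℝ 1 φ
  compact : HasCompactSupport φ
  tsupport_subset : tsupport φ ⊆ Ω
  norm_le : ∀ x, ‖φ x‖ ≤ 1

lemma IsTestField.zero (Ω : Set Plane) : IsTestField Ω 0 :=
  ⟨contDiff_const, HasCompactSupport.zero, by simp [tsupport], by simp⟩

lemma IsTestField.le_totalVar {Ω : Set Plane} {u : Plane → ℝ} (hu : BddAbove (TVtest Ω u))
    {φ : Plane → Plane} (hφ : IsTestField Ω φ) : ∫ x in Ω, u x * divg φ x ≤ totalVar Ω u :=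
  le_csSup hu ⟨φ, hφ.1, hφ.2, hφ.3, hφ.4, rfl⟩

lemma IsTestField.comp_add {Ω : Set Plane} {φ : Plane → Plane} {δ : ℝ}
    (hφ : IsTestField Ω φ) (hδ : cthickening δ (tsupport φ) ⊆ Ω) {y : Plane} (hy : ‖y‖ ≤ δ) :
    IsTestField Ω fun x => φ (x + y) where
  contDiff := hφ.contDiff.comp (contDiff_id.add contDiff_const)
  compact := hφ.compact.comp_homeomorph (Homeomorph.addRight y)
  tsupport_subset x hx := by
    have : x + y ∈ tsupport φ :=
      (tsupport_comp_subset_preimage φ (f := fun x => x + y) (by fun_prop)) hx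
    exact hδ (mem_cthickening_of_dist_le x (x + y) δ _ this (by simpa [dist_eq_norm] using hy))
  norm_le x := hφ.norm_le _

section Mollification

open scoped Convolution

lemma integral_convolution_mul (φ : ContDiffBump (0 : Plane)) {v g : Plane → ℝ}
    (hv : Integrable v) (hg : Continuous g) (hgc : HasCompactSupport g) :
    ∫ x, (φ.normed volume ⋆[ContinuousLinearMap.lsmul ℝ ℝ, volume] v) x * g x =
      ∫ y, φ.normed volume y * ∫ x, v x * g (x + y) := by
  obtain ⟨C, hC⟩ := hgc.exists_bound_of_continuous hg
  have hi : Integrable (fun p : Plane × Plane =>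
      φ.normed volume p.2 * v (p.1 - p.2) * g p.1) (volume.prod volume) := by
    have h1 : Integrable (fun p : Plane × Plane =>
        ContinuousLinearMap.lsmul ℝ ℝ (φ.normed volume p.2) (v (p.1 - p.2)))
        (volume.prod volume) :=
      Integrable.convolution_integrand (ContinuousLinearMap.lsmul ℝ ℝ) φ.integrable_normed hv
    exact h1.mul_bdd (c := C) (hg.comp continuous_fst).aestronglyMeasurable
      (Eventually.of_forall fun p => hC _)
  calc ∫ x, (φ.normed volume ⋆[ContinuousLinearMap.lsmul ℝ ℝ, volume] v) x * g x
      = ∫ x, ∫ y, φ.normed volume y * v (x - y) * g x := by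
        congr with x
        rw [convolution_def, ← integral_mul_const]
        rfl
    _ = ∫ y, ∫ x, φ.normed volume y * v (x - y) * g x := integral_integral_swap hi
    _ = _ := by
        congr with y
        rw [← integral_const_mul, ← integral_add_right_eq_self _ y]
        congr with x
        simp [mul_assoc]

lemma continuous_integral_mul_comp_add {v g : Plane → ℝ}
    (hv : Integrable v) (hg : Continuous g) (hgc : HasCompactSupport g) :
    Continuous fun y => ∫ x, v x * g (x + y) := by
  obtain ⟨C, hC⟩ := hgc.exists_bound_of_continuous hg
  refine continuous_of_dominated (bound := fun x => ‖v x‖ * C) ?_ ?_ (hv.norm.mul_const C) ?_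
  · intro y
    exact hv.aestronglyMeasurable.mul (by fun_prop)
  · intro y
    refine Eventually.of_forall fun x => ?_
    rw [norm_mul]
    exact mul_le_mul_of_nonneg_left (hC _) (norm_nonneg _)
  · exact Eventually.of_forall fun x => by fun_prop

lemma integral_convolution_mul_divg_le {Ω : Set Plane} (hΩ : MeasurableSet Ω) {u : Plane → ℝ}
    (hu : BVOn u Ω) {Ψ : Plane → Plane} (hΨ : IsTestField Ω Ψ) (φ : ContDiffBump (0 : Plane))
    (hφ : cthickening φ.rOut (tsupport Ψ) ⊆ Ω) :
    ∫ x, (φ.normed volume ⋆[ContinuousLinearMap.lsmul ℝ ℝ, volume] Ω.indicator u) x * divg Ψ x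
      ≤ totalVar Ω u := by
  have hv : Integrable (Ω.indicator u) := (integrable_indicator_iff hΩ).2 hu.1
  have hd := continuous_divg hΨ.contDiff
  have hdc := hasCompactSupport_divg hΨ.compact
  rw [integral_convolution_mul φ hv hd hdc]
  have hh := continuous_integral_mul_comp_add hv hd hdc
  calc ∫ y, φ.normed volume y * ∫ x, Ω.indicator u x * divg Ψ (x + y)
      ≤ ∫ y, φ.normed volume y * totalVar Ω u := by
        refine integral_mono ?_ (φ.integrable_normed.mul_const _) fun y => ?_
        · exact (φ.continuous_normed.mul hh).integrable_of_hasCompactSupport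
            φ.hasCompactSupport_normed.mul_right
        by_cases hy : y ∈ ball (0 : Plane) φ.rOut
        · refine mul_le_mul_of_nonneg_left ?_ (φ.nonneg_normed y)
          have := (hΨ.comp_add hφ (y := y) (by simpa using (mem_ball.1 hy).le)).le_totalVar hu.2
          refine le_trans (le_of_eq ?_) this
          rw [← integral_indicator hΩ]
          congr with x
          by_cases hx : x ∈ Ω <;> simp [hx, divg_comp_add]
        · have : φ.normed volume y = 0 := by
            rw [← Function.notMem_support, φ.support_normed_eq]
            exact hy
          simp [this]
    _ = totalVar Ω u := by rw [integral_mul_const, φ.integral_normed, one_mul]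

lemma exists_testField_integral_split {Ω : Set Plane} {U : Plane → ℝ} (hU : ContDiff ℝ 2 U)
    {f : ℝ → ℝ} (hf : ContDiff ℝ 2 f) (hf0 : ∀ t, 0 ≤ deriv f t)
    (hf1 : ∀ t, deriv f t ≤ 1) {ψ₁ ψ₂ : Plane → Plane}
    (h₁ : IsTestField Ω ψ₁) (h₂ : IsTestField Ω ψ₂) :
    ∃ Ψ, IsTestField Ω Ψ ∧ tsupport Ψ ⊆ tsupport ψ₁ ∪ tsupport ψ₂ ∧
      ∫ x, U x * divg Ψ x =
        (∫ x, U x * divg ψ₁ x) + ∫ x, f (U x) * (divg ψ₂ x - divg ψ₁ x) := by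
  have hK : IsCompact (tsupport ψ₁ ∪ tsupport ψ₂) := h₁.compact.isCompact.union h₂.compact
  have hd₁ := continuous_divg h₁.contDiff
  have hdc₁ := hasCompactSupport_divg h₁.compact
  have hf' : ContDiff ℝ 1 (deriv f) := by
    have : ContDiff ℝ (1 + 1) f := hf
    exact (contDiff_succ_iff_deriv.1 this).2.2
  have hU1 : ContDiff ℝ 1 U := hU.of_le (by norm_num)
  have hχ : ContDiff ℝ 1 fun x => deriv f (U x) • (ψ₂ x - ψ₁ x) :=
    (hf'.comp hU1).smul (h₂.contDiff.sub h₁.contDiff)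
  have hχc : HasCompactSupport fun x => deriv f (U x) • (ψ₂ x - ψ₁ x) :=
    (h₂.compact.sub h₁.compact).mono fun x hx h0 => hx (by
      change ψ₂ x - ψ₁ x = 0 at h0
      simp [h0])
  set Ψ : Plane → Plane := ψ₁ + fun x => deriv f (U x) • (ψ₂ x - ψ₁ x) with hΨ
  have hsupp : tsupport Ψ ⊆ tsupport ψ₁ ∪ tsupport ψ₂ := by
    refine closure_minimal (fun x hx => ?_) (hK.isClosed)
    by_contra h
    rw [mem_union, not_or] at h
    exact hx (by simp [hΨ, image_eq_zero_of_notMem_tsupport h.1,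
      image_eq_zero_of_notMem_tsupport h.2])
  have htest : IsTestField Ω Ψ := by
    have hadd : ContDiff ℝ 1 Ψ := h₁.contDiff.add hχ
    have haddc : HasCompactSupport Ψ := h₁.compact.add hχc
    refine ⟨hadd, haddc, hsupp.trans
      (union_subset h₁.tsupport_subset h₂.tsupport_subset), fun x => ?_⟩
    have : Ψ x = (1 - deriv f (U x)) • ψ₁ x + deriv f (U x) • ψ₂ x := by
      simp only [hΨ, Pi.add_apply]
      module
    rw [this]
    have hconv := convex_closedBall (0 : Plane) 1
      (mem_closedBall_zero_iff.2 (h₁.norm_le x)) (mem_closedBall_zero_iff.2 (h₂.norm_le x))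
      (sub_nonneg.2 (hf1 (U x))) (hf0 (U x)) (sub_add_cancel _ _)
    exact mem_closedBall_zero_iff.1 hconv
  refine ⟨Ψ, htest, hsupp, ?_⟩
  have hUc := hU1.continuous
  have hdχ := continuous_divg hχ
  have key : ∫ x, f (U x) * (divg ψ₂ x - divg ψ₁ x) =
      ∫ x, U x * divg (fun x => deriv f (U x) • (ψ₂ x - ψ₁ x)) x := by
    rw [integral_mul_divg hU1 hχ hχc]
    have hsub : (fun x => divg ψ₂ x - divg ψ₁ x) = divg (ψ₂ - ψ₁) := by
      ext x
      rw [sub_eq_add_neg ψ₂, ← neg_one_smul ℝ ψ₁,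
        divg_add (h₂.contDiff.differentiable (by simp) x)
          ((h₁.contDiff.differentiable (by simp) x).const_smul _),
        divg_const_smul _ (h₁.contDiff.differentiable (by simp) x)]
      ring
    have := integral_mul_divg (g := fun x => f (U x)) (ψ := ψ₂ - ψ₁)
      ((hf.comp hU).of_le (by norm_num))
      (h₂.contDiff.sub h₁.contDiff) (h₂.compact.sub h₁.compact)
    calc _ = ∫ x, f (U x) * divg (ψ₂ - ψ₁) x := by rw [← hsub]
      _ = _ := by
        rw [this]
        congr with x
        have hc := ((hf.differentiable (by simp) (U x)).hasDerivAt.comp_hasFDerivAt x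
          (hU.differentiable (by simp) x).hasFDerivAt).fderiv
        change fderiv ℝ (f ∘ U) x _ = _
        rw [hc]
        simp
  have hadd : ∀ x, U x * divg Ψ x = U x * divg ψ₁ x +
      U x * divg (fun x => deriv f (U x) • (ψ₂ x - ψ₁ x)) x := fun x => by
    rw [hΨ, divg_add (h₁.contDiff.differentiable (by simp) x)
      (hχ.differentiable (by simp) x), mul_add]
  simp_rw [hadd]
  rw [integral_add, key]
  · exact (hUc.mul hd₁).integrable_of_hasCompactSupport hdc₁.mul_left
  · exact (hUc.mul hdχ).integrable_of_hasCompactSupport (hasCompactSupport_divg hχc).mul_left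

/-- One half of the coarea splitting of the total variation into the parts carried by
`u - f ∘ u` and `f ∘ u`. -/
lemma integral_split_le_totalVar {Ω : Set Plane} (hΩ : IsOpen Ω) {u : Plane → ℝ}
    (hu : BVOn u Ω) {f : ℝ → ℝ} (hf : ContDiff ℝ 2 f) (hf0 : ∀ t, 0 ≤ deriv f t)
    (hf1 : ∀ t, deriv f t ≤ 1) {M : ℝ} (hfM : ∀ t, |f t| ≤ M) {ψ₁ ψ₂ : Plane → Plane}
    (h₁ : IsTestField Ω ψ₁) (h₂ : IsTestField Ω ψ₂) :
    (∫ x in Ω, u x * divg ψ₁ x) + ∫ x in Ω, f (u x) * (divg ψ₂ x - divg ψ₁ x) ≤ totalVar Ω u := by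
  set v := Ω.indicator u with hvdef
  have hv : Integrable v := (integrable_indicator_iff hΩ.measurableSet).2 hu.1
  have hK : IsCompact (tsupport ψ₁ ∪ tsupport ψ₂) := h₁.compact.isCompact.union h₂.compact
  obtain ⟨δ, hδ, hδΩ⟩ := hK.exists_cthickening_subset_open hΩ
    (union_subset h₁.tsupport_subset h₂.tsupport_subset)
  let φ : ℕ → ContDiffBump (0 : Plane) := fun n =>
    ⟨(1 / 2) * (1 / ((n : ℝ) + 1)), 1 / ((n : ℝ) + 1), by positivity, by
      have : 0 < 1 / ((n : ℝ) + 1) := by positivity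
      linarith⟩
  have hφ : Tendsto (fun n => (φ n).rOut) atTop (𝓝 0) := tendsto_one_div_add_atTop_nhds_zero_nat
  let U : ℕ → Plane → ℝ := fun n =>
    (φ n).normed volume ⋆[ContinuousLinearMap.lsmul ℝ ℝ, volume] v
  have hU (n : ℕ) : ContDiff ℝ 2 (U n) :=
    HasCompactSupport.contDiff_convolution_left _ (φ n).hasCompactSupport_normed
      (φ n).contDiff_normed hv.locallyIntegrable
  have hUae : ∀ᵐ x, Tendsto (fun n => U n x) atTop (𝓝 (v x)) :=
    ContDiffBump.ae_convolution_tendsto_right_of_locallyIntegrable (K := 2) hφ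
      (Eventually.of_forall fun n => by simp [φ]) hv.locallyIntegrable
  have hd₁ := continuous_divg h₁.contDiff
  have hd₂ := continuous_divg h₂.contDiff
  have hdc₁ := hasCompactSupport_divg h₁.compact
  have hdc₂ := hasCompactSupport_divg h₂.compact
  have lim₁ : Tendsto (fun n => ∫ x, U n x * divg ψ₁ x) atTop (𝓝 (∫ x in Ω, u x * divg ψ₁ x)) := by
    have hh := (continuous_integral_mul_comp_add hv hd₁ hdc₁).comp continuous_neg
    have := ContDiffBump.convolution_tendsto_right_of_continuous (μ := volume) hφ hh 0
    convert this using 1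
    · ext n
      rw [integral_convolution_mul (φ n) hv hd₁ hdc₁, convolution_def]
      simp
    · congr 1
      rw [← integral_indicator hΩ.measurableSet]
      simp [hvdef, indicator_mul_left]
  have lim₂ : Tendsto (fun n => ∫ x, f (U n x) * (divg ψ₂ x - divg ψ₁ x)) atTop
      (𝓝 (∫ x in Ω, f (u x) * (divg ψ₂ x - divg ψ₁ x))) := by
    have heq : ∫ x in Ω, f (u x) * (divg ψ₂ x - divg ψ₁ x) =
        ∫ x, f (v x) * (divg ψ₂ x - divg ψ₁ x) := by
      rw [← integral_indicator hΩ.measurableSet]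
      congr with x
      by_cases hx : x ∈ Ω
      · simp [hvdef, hx]
      · simp [hx, divg_eq_zero fun h => hx (h₁.tsupport_subset h),
          divg_eq_zero fun h => hx (h₂.tsupport_subset h)]
    rw [heq]
    refine tendsto_integral_of_dominated_convergence
      (fun x => M * ‖divg ψ₂ x - divg ψ₁ x‖) ?_ ?_ ?_ ?_
    · intro n
      have := (hU n).continuous
      have := hf.continuous
      fun_prop
    · exact ((hd₂.integrable_of_hasCompactSupport hdc₂).sub
        (hd₁.integrable_of_hasCompactSupport hdc₁)).norm.const_mul M
    · intro n
      refine Eventually.of_forall fun x => ?_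
      rw [norm_mul]
      exact mul_le_mul_of_nonneg_right (hfM _) (norm_nonneg _)
    · filter_upwards [hUae] with x hx
      exact ((hf.continuous.tendsto _).comp hx).mul_const _
  refine le_of_tendsto (lim₁.add lim₂) ?_
  filter_upwards [hφ.eventually (gt_mem_nhds hδ)] with n hn
  obtain ⟨Ψ, hΨ, hsupp, heq⟩ := exists_testField_integral_split (hU n) hf hf0 hf1 h₁ h₂
  rw [← heq]
  exact integral_convolution_mul_divg_le hΩ.measurableSet hu hΨ (φ n)
    ((cthickening_mono hn.le _).trans ((cthickening_subset_of_subset _ hsupp).trans hδΩ))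

end Mollification

lemma MeasureTheory.IntegrableOn.mul_of_hasCompactSupport {Ω : Set Plane} {w g : Plane → ℝ}
    (hw : IntegrableOn w Ω) (hg : Continuous g) (hgc : HasCompactSupport g) :
    IntegrableOn (fun x => w x * g x) Ω := by
  obtain ⟨C, hC⟩ := hgc.exists_bound_of_continuous hg
  exact hw.mul_bdd (c := C) hg.aestronglyMeasurable (Eventually.of_forall hC)

lemma IsTestField.smul {Ω : Set Plane} {η : Plane → ℝ} {ψ : Plane → Plane} (hη : ContDiff ℝ 1 η)
    (hη1 : ∀ x, |η x| ≤ 1) (hψ : IsTestField Ω ψ) : IsTestField Ω fun x => η x • ψ x where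
  contDiff := hη.smul hψ.contDiff
  compact := hψ.compact.mono fun x hx h0 => hx (by simp [h0])
  tsupport_subset :=
    (closure_mono (show Function.support (fun x => η x • ψ x) ⊆ Function.support ψ from
      fun x hx h0 => hx (by simp [h0]))).trans hψ.tsupport_subset
  norm_le x := by
    rw [norm_smul]
    exact mul_le_one₀ (hη1 x) (norm_nonneg _) (hψ.norm_le x)

/-- Comparing a least gradient function `u` with `u - η • f ∘ u` for a cutoff `η` bounds the
variation of `f ∘ u` by the cost of the transition layer of `η`. -/
lemma LeastGradientOn.integral_mul_divg_le {Ω : Set Plane} (hΩ : IsOpen Ω) {u : Plane → ℝ}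
    (hu : LeastGradientOn u Ω) {f : ℝ → ℝ} (hf : ContDiff ℝ 2 f) (hf0 : ∀ t, 0 ≤ deriv f t)
    (hf1 : ∀ t, deriv f t ≤ 1) {M : ℝ} (hfM : ∀ t, |f t| ≤ M) (hfpos : ∀ t, 0 ≤ f t)
    (hw : IntegrableOn (fun x => f (u x)) Ω) {η κ : Plane → ℝ} (hη : ContDiff ℝ 1 η)
    (hηc : HasCompactSupport η) (hηΩ : tsupport η ⊆ Ω) (hη0 : ∀ x, 0 ≤ η x) (hη1 : ∀ x, η x ≤ 1)
    (hκ : IntegrableOn (fun x => f (u x) * κ x) Ω)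
    (hηκ : ∀ x v, ‖v‖ ≤ 1 → fderiv ℝ η x v ≤ κ x) {Ψ : Plane → Plane} (hΨ : IsTestField Ω Ψ)
    (hΨη : ∀ x, Ψ x ≠ 0 → η x = 1) :
    ∫ x in Ω, f (u x) * divg Ψ x ≤ ∫ x in Ω, f (u x) * κ x := by
  have hηd := hη.differentiable (by simp)
  have hη' := hη.continuous_fderiv (by simp)
  have iη {ψ : Plane → Plane} (hψ : IsTestField Ω ψ) :
      IntegrableOn (fun x => f (u x) * (η x * divg ψ x)) Ω :=
    hw.mul_of_hasCompactSupport (hη.continuous.mul (continuous_divg hψ.contDiff)) hηc.mul_right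
  have idiv {ψ : Plane → Plane} (hψ : IsTestField Ω ψ) :
      IntegrableOn (fun x => f (u x) * divg ψ x) Ω :=
    hw.mul_of_hasCompactSupport (continuous_divg hψ.contDiff) (hasCompactSupport_divg hψ.compact)
  have iD {ψ : Plane → Plane} (hψ : IsTestField Ω ψ) :
      IntegrableOn (fun x => f (u x) * fderiv ℝ η x (ψ x)) Ω := by
    refine hw.mul_of_hasCompactSupport (hη'.clm_apply hψ.contDiff.continuous) ?_
    exact hψ.compact.mono fun x hx h0 => hx (by simp [h0])
  have Dle {ψ : Plane → Plane} (hψ : IsTestField Ω ψ) :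
      ∫ x in Ω, f (u x) * fderiv ℝ η x (ψ x) ≤ ∫ x in Ω, f (u x) * κ x :=
    integral_mono (iD hψ) hκ fun x =>
      mul_le_mul_of_nonneg_left (hηκ x _ (hψ.norm_le x)) (hfpos _)
  set φ : Plane → ℝ := fun x => -(f (u x) * η x) with hφ
  have hφc : HasCompactSupport φ := hηc.mono fun x hx h0 => hx (by simp [hφ, h0])
  have hφΩ : tsupport φ ⊆ Ω :=
    (closure_mono (show Function.support φ ⊆ Function.support η from
      fun x hx h0 => hx (by simp [hφ, h0]))).trans hηΩ
  have hφi : IntegrableOn φ Ω := (hw.mul_of_hasCompactSupport hη.continuous hηc).neg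
  have hφBV : BVOn φ Ω := by
    refine ⟨hφi, totalVar Ω u + ∫ x in Ω, f (u x) * κ x, ?_⟩
    rintro r ⟨ψ, h1, h2, h3, h4, rfl⟩
    have hψ : IsTestField Ω ψ := ⟨h1, h2, h3, h4⟩
    have hψ' : IsTestField Ω fun x => (-η x) • ψ x :=
      hψ.smul hη.neg fun x => by rw [abs_neg, abs_of_nonneg (hη0 x)]; exact hη1 x
    have := integral_split_le_totalVar hΩ hu.1 hf hf0 hf1 hfM (IsTestField.zero Ω) hψ'
    have hz (x : Plane) : divg 0 x = 0 := divg_eq_zero (by simp [tsupport])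
    simp only [hz, mul_zero, integral_zero, zero_add, sub_zero] at this
    have heq : ∫ x in Ω, φ x * divg ψ x = (∫ x in Ω, f (u x) * divg (fun x => (-η x) • ψ x) x) +
        ∫ x in Ω, f (u x) * fderiv ℝ η x (ψ x) := by
      rw [← integral_add (idiv hψ') (iD hψ)]
      congr with x
      rw [divg_smul (hηd x).fun_neg (h1.differentiable (by simp) x), fderiv_fun_neg]
      simp only [hφ, neg_apply]
      ring
    rw [heq]
    exact add_le_add this (Dle hψ)
  have hle := hu.2 φ hφBV hφc hφΩ
  have hge : totalVar Ω (u + φ) ≤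
      totalVar Ω u - (∫ x in Ω, f (u x) * divg Ψ x) + ∫ x in Ω, f (u x) * κ x := by
    refine csSup_le ⟨_, 0, (IsTestField.zero Ω).1, (IsTestField.zero Ω).2, (IsTestField.zero Ω).3,
      (IsTestField.zero Ω).4, rfl⟩ ?_
    rintro r ⟨ψ, h1, h2, h3, h4, rfl⟩
    have hψ : IsTestField Ω ψ := ⟨h1, h2, h3, h4⟩
    have hψ' : IsTestField Ω fun x => (1 - η x) • ψ x :=
      hψ.smul (contDiff_const.sub hη) fun x => by
        rw [abs_le]
        constructor <;> linarith [hη0 x, hη1 x]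
    have hsum : IsTestField Ω (Ψ + fun x => (1 - η x) • ψ x) := by
      have hc : ContDiff ℝ 1 (Ψ + fun x => (1 - η x) • ψ x) := hΨ.contDiff.add hψ'.contDiff
      have hcc : HasCompactSupport (Ψ + fun x => (1 - η x) • ψ x) := hΨ.compact.add hψ'.compact
      refine ⟨hc, hcc, (tsupport_add _ _).trans
        (union_subset hΨ.tsupport_subset hψ'.tsupport_subset), fun x => ?_⟩
      by_cases hx : Ψ x = 0
      · simpa [hx] using hψ'.norm_le x
      · simpa [hΨη x hx] using hΨ.norm_le x
    have := integral_split_le_totalVar hΩ hu.1 hf hf0 hf1 hfM hψ hsum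
    have iu : IntegrableOn (fun x => u x * divg ψ x) Ω :=
      hu.1.1.mul_of_hasCompactSupport (continuous_divg h1) (hasCompactSupport_divg h2)
    have e1 : ∫ x in Ω, (u + φ) x * divg ψ x =
        (∫ x in Ω, u x * divg ψ x) - ∫ x in Ω, f (u x) * (η x * divg ψ x) := by
      rw [← integral_sub iu (iη hψ)]
      congr with x
      simp only [hφ, Pi.add_apply]
      ring
    have e2 : ∫ x in Ω, f (u x) * (divg (Ψ + fun x => (1 - η x) • ψ x) x - divg ψ x) =
        (∫ x in Ω, f (u x) * divg Ψ x) - (∫ x in Ω, f (u x) * (η x * divg ψ x)) -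
          ∫ x in Ω, f (u x) * fderiv ℝ η x (ψ x) := by
      rw [← integral_sub (idiv hΨ) (iη hψ), ← integral_sub _ (iD hψ)]
      · congr with x
        rw [divg_add (hΨ.contDiff.differentiable (by simp) x)
          (hψ'.contDiff.differentiable (by simp) x),
          divg_smul ((hηd x).const_sub 1) (h1.differentiable (by simp) x), fderiv_const_sub]
        simp only [neg_apply]
        ring
      · exact (idiv hΨ).sub (iη hψ)
    rw [e1]
    linarith [Dle hψ]
  linarith

section Layers

local notation "S" => Real.smoothTransition

lemma contDiff_smoothTransition (k : ℕ) : ContDiff ℝ k S :=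
  Real.smoothTransition.contDiff (n := (k : ℕ∞))

lemma hasDerivAt_smoothTransition (x : ℝ) : HasDerivAt S (deriv S x) x :=
  ((contDiff_smoothTransition 1).differentiable (by simp) x).hasDerivAt

lemma contDiff_deriv_smoothTransition : ContDiff ℝ 1 (deriv S) := by
  have : ContDiff ℝ (1 + 1) S := contDiff_smoothTransition 2
  exact (contDiff_succ_iff_deriv.1 this).2.2

lemma deriv_smoothTransition_nonneg (x : ℝ) : 0 ≤ deriv S x :=
  Real.smoothTransition.monotone.deriv_nonneg

lemma mem_Icc_of_deriv_smoothTransition_ne_zero {x : ℝ} (h : deriv S x ≠ 0) : x ∈ Icc 0 1 := by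
  constructor
  · by_contra! hx
    refine h ?_
    have : S =ᶠ[𝓝 x] fun _ => 0 := by
      filter_upwards [Iio_mem_nhds hx] with y hy
      exact Real.smoothTransition.zero_of_nonpos (le_of_lt hy)
    rw [this.deriv_eq, deriv_const]
  · by_contra! hx
    refine h ?_
    have : S =ᶠ[𝓝 x] fun _ => 1 := by
      filter_upwards [Ioi_mem_nhds hx] with y hy
      exact Real.smoothTransition.one_of_one_le (le_of_lt hy)
    rw [this.deriv_eq, deriv_const]

lemma exists_deriv_smoothTransition_le : ∃ K, 0 < K ∧ ∀ x, deriv S x ≤ K := by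
  have hc : HasCompactSupport (deriv S) :=
    HasCompactSupport.intro isCompact_Icc fun x hx => by
      by_contra h
      exact hx (mem_Icc_of_deriv_smoothTransition_ne_zero h)
  obtain ⟨K, hK⟩ := hc.exists_bound_of_continuous contDiff_deriv_smoothTransition.continuous
  exact ⟨|K| + 1, by positivity, fun x => by
    linarith [le_abs_self (deriv S x), hK x, Real.norm_eq_abs (deriv S x), le_abs_self K]⟩

/-- A unit mass concentrating at the right endpoint of `(-ℓ, ℓ)` as `n → ∞`. -/
def layer (ℓ : ℝ) (n : ℕ) (s : ℝ) : ℝ := n * deriv S (n * (ℓ - s) - 1)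

/-- A cutoff function supported in `(-ℓ, ℓ)`, increasing to `1` as `n → ∞`. -/
def cutoff (ℓ : ℝ) (n : ℕ) (s : ℝ) : ℝ := S (n * (ℓ - s) - 1) * S (n * (ℓ + s) - 1)

lemma layer_nonneg (ℓ : ℝ) (n : ℕ) (s : ℝ) : 0 ≤ layer ℓ n s :=
  mul_nonneg n.cast_nonneg (deriv_smoothTransition_nonneg _)

lemma contDiff_layer (ℓ : ℝ) (n : ℕ) : ContDiff ℝ 1 (layer ℓ n) :=
  contDiff_const.mul (contDiff_deriv_smoothTransition.comp (by fun_prop))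

lemma contDiff_cutoff (ℓ : ℝ) (n : ℕ) : ContDiff ℝ 1 (cutoff ℓ n) :=
  ((contDiff_smoothTransition 1).comp (by fun_prop)).mul
    ((contDiff_smoothTransition 1).comp (by fun_prop))

lemma cutoff_nonneg (ℓ : ℝ) (n : ℕ) (s : ℝ) : 0 ≤ cutoff ℓ n s :=
  mul_nonneg (Real.smoothTransition.nonneg _) (Real.smoothTransition.nonneg _)

lemma cutoff_le_one (ℓ : ℝ) (n : ℕ) (s : ℝ) : cutoff ℓ n s ≤ 1 :=
  mul_le_one₀ (Real.smoothTransition.le_one _) (Real.smoothTransition.nonneg _)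
    (Real.smoothTransition.le_one _)

lemma cutoff_eq_one {ℓ : ℝ} {n : ℕ} {s : ℝ} (h : 2 ≤ n * (ℓ - |s|)) : cutoff ℓ n s = 1 := by
  have h1 : (n : ℝ) * (ℓ - |s|) ≤ n * (ℓ - s) :=
    mul_le_mul_of_nonneg_left (by linarith [le_abs_self s]) n.cast_nonneg
  have h2 : (n : ℝ) * (ℓ - |s|) ≤ n * (ℓ + s) :=
    mul_le_mul_of_nonneg_left (by linarith [neg_abs_le s]) n.cast_nonneg
  rw [cutoff, Real.smoothTransition.one_of_one_le (by linarith),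
    Real.smoothTransition.one_of_one_le (by linarith), one_mul]

lemma tendsto_cutoff {ℓ s : ℝ} (h : |s| < ℓ) :
    Tendsto (fun n => cutoff ℓ n s) atTop (𝓝 1) := by
  refine tendsto_const_nhds.congr' ?_
  filter_upwards [(tendsto_natCast_atTop_atTop.atTop_mul_const
    (sub_pos.2 h)).eventually_ge_atTop 2] with n hn
  exact (cutoff_eq_one hn).symm

lemma abs_le_of_cutoff_ne_zero {ℓ : ℝ} {n : ℕ} (hn : 0 < n) {s : ℝ} (h : cutoff ℓ n s ≠ 0) :
    |s| ≤ ℓ - 1 / n := by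
  have hn' : (0 : ℝ) < n := by exact_mod_cast hn
  have h1 := left_ne_zero_of_mul h
  have h2 := right_ne_zero_of_mul h
  rw [ne_eq, Real.smoothTransition.zero_iff_nonpos, not_le] at h1 h2
  have h3 : 1 / (n : ℝ) ≤ ℓ - s := by
    rw [div_le_iff₀ hn']
    linarith
  have h4 : 1 / (n : ℝ) ≤ ℓ + s := by
    rw [div_le_iff₀ hn']
    linarith
  rw [abs_le]
  constructor <;> linarith

lemma mem_Icc_of_layer_ne_zero {ℓ : ℝ} {n : ℕ} {s : ℝ} (h : layer ℓ n s ≠ 0) :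
    n * (ℓ - s) - 1 ∈ Icc (0 : ℝ) 1 :=
  mem_Icc_of_deriv_smoothTransition_ne_zero (right_ne_zero_of_mul h)

lemma abs_le_of_layer_ne_zero {ℓ : ℝ} {n : ℕ} (hn : 0 < n) (hℓ : 2 ≤ n * ℓ) {s : ℝ}
    (h : layer ℓ n s ≠ 0) : |s| ≤ ℓ - 1 / n := by
  have hn' : (0 : ℝ) < n := by exact_mod_cast hn
  obtain ⟨h1, h2⟩ := mem_Icc_of_layer_ne_zero h
  have h3 : 1 / (n : ℝ) ≤ ℓ - s := by
    rw [div_le_iff₀ hn']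
    linarith
  have h4 : 1 / (n : ℝ) ≤ ℓ + s := by
    rw [div_le_iff₀ hn']
    linarith
  rw [abs_le]
  constructor <;> linarith

lemma deriv_cutoff {ℓ : ℝ} {n : ℕ} (hℓ : 2 ≤ n * ℓ) (s : ℝ) :
    deriv (cutoff ℓ n) s = layer ℓ n (-s) - layer ℓ n s := by
  have h1 : HasDerivAt (fun s => S (n * (ℓ - s) - 1))
      (deriv S (n * (ℓ - s) - 1) * (n * (0 - 1) - 0)) s :=
    (hasDerivAt_smoothTransition _).comp s
      ((((hasDerivAt_const s ℓ).sub (hasDerivAt_id s)).const_mul (n : ℝ)).sub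
        (hasDerivAt_const s 1))
  have h2 : HasDerivAt (fun s => S (n * (ℓ + s) - 1))
      (deriv S (n * (ℓ + s) - 1) * (n * (0 + 1) - 0)) s :=
    (hasDerivAt_smoothTransition _).comp s
      ((((hasDerivAt_const s ℓ).add (hasDerivAt_id s)).const_mul (n : ℝ)).sub
        (hasDerivAt_const s 1))
  have h3 : deriv (cutoff ℓ n) s = _ := (h1.mul h2).deriv
  have h4 (s : ℝ) : layer ℓ n s * S (n * (ℓ + s) - 1) = layer ℓ n s := by
    by_cases h : layer ℓ n s = 0
    · simp [h]
    · have := (mem_Icc_of_layer_ne_zero h).2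
      rw [Real.smoothTransition.one_of_one_le (by linarith), mul_one]
  have h5 := h4 s
  have h6 := h4 (-s)
  rw [h3, ← h5, ← h6]
  simp only [layer, sub_neg_eq_add, ← sub_eq_add_neg]
  ring

lemma integral_layer {ℓ : ℝ} (hℓ : 0 < ℓ) (n : ℕ) :
    ∫ s in Ioo (-ℓ) ℓ, layer ℓ n s = S (n * (2 * ℓ) - 1) := by
  rw [← integral_Ioc_eq_integral_Ioo, ← intervalIntegral.integral_of_le (by linarith)]
  have h1 (s : ℝ) : HasDerivAt (fun s => -S (n * (ℓ - s) - 1)) (layer ℓ n s) s := by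
    have : HasDerivAt (fun s => S (n * (ℓ - s) - 1))
      (deriv S (n * (ℓ - s) - 1) * (n * (0 - 1) - 0)) s :=
      (hasDerivAt_smoothTransition _).comp s
        ((((hasDerivAt_const s ℓ).sub (hasDerivAt_id s)).const_mul (n : ℝ)).sub
          (hasDerivAt_const s 1))
    exact this.fun_neg.congr_deriv (by rw [layer]; ring)
  rw [intervalIntegral.integral_eq_sub_of_hasDerivAt (fun s _ => h1 s)
    ((contDiff_layer ℓ n).continuous.intervalIntegrable _ _)]
  rw [Real.smoothTransition.zero_of_nonpos (x := n * (ℓ - ℓ) - 1) (by simp)]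
  rw [show (n : ℝ) * (ℓ - -ℓ) - 1 = n * (2 * ℓ) - 1 by ring]
  ring

lemma tendsto_integral_layer {ℓ : ℝ} (hℓ : 0 < ℓ) {G : ℝ → ℝ} {c : ℝ}
    (hG : IntegrableOn G (Ioo (-ℓ) ℓ)) (hc : Tendsto G (𝓝[<] ℓ) (𝓝 c)) :
    Tendsto (fun n => ∫ s in Ioo (-ℓ) ℓ, layer ℓ n s * G s) atTop (𝓝 c) := by
  have hnhds : 𝓝[Ioo (-ℓ) ℓ] ℓ = 𝓝[<] ℓ := nhdsWithin_Ioo_eq_nhdsLT (by linarith)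
  have := tendsto_setIntegral_peak_smul_of_integrableOn_of_tendsto (μ := volume)
    (s := Ioo (-ℓ) ℓ) (t := Ioo (-ℓ) ℓ) (x₀ := ℓ) (l := atTop) (φ := layer ℓ) (g := G) (a := c)
    measurableSet_Ioo measurableSet_Ioo le_rfl self_mem_nhdsWithin (by simp)
    (Eventually.of_forall fun n s _ => layer_nonneg ℓ n s) ?_ ?_
    (Eventually.of_forall fun n => (contDiff_layer ℓ n).continuous.aestronglyMeasurable) hG
    (by rwa [hnhds])
  · simpa using this
  · intro V hV hℓV
    obtain ⟨δ, hδ, hδV⟩ := Metric.isOpen_iff.1 hV ℓ hℓV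
    rw [Metric.tendstoUniformlyOn_iff]
    intro ε hε
    filter_upwards [(tendsto_natCast_atTop_atTop.atTop_mul_const hδ).eventually_gt_atTop 2]
      with n hn s hs
    have h0 : layer ℓ n s = 0 := by
      by_contra h
      have h1 := (mem_Icc_of_layer_ne_zero h).2
      refine hs.2 (hδV ?_)
      rw [mem_ball, Real.dist_eq, abs_sub_comm, abs_of_pos (by linarith [hs.1.2])]
      by_contra! h2
      have := mul_le_mul_of_nonneg_left h2 (n.cast_nonneg (α := ℝ))
      linarith
    simpa [h0] using hε
  · simp_rw [integral_layer hℓ]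
    refine tendsto_const_nhds.congr' ?_
    filter_upwards [(tendsto_natCast_atTop_atTop.atTop_mul_const
      (by positivity : 0 < 2 * ℓ)).eventually_ge_atTop 2] with n hn
    rw [Real.smoothTransition.one_of_one_le (by linarith)]

lemma abs_integral_layer_mul_le {ℓ : ℝ} (hℓ : 0 < ℓ) (n : ℕ) {G : ℝ → ℝ} {M : ℝ}
    (hM : ∀ s ∈ Ioo (-ℓ) ℓ, |G s| ≤ M) :
    |∫ s in Ioo (-ℓ) ℓ, layer ℓ n s * G s| ≤ M := by
  have hM0 : 0 ≤ M := (abs_nonneg _).trans (hM 0 ⟨by linarith, hℓ⟩)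
  have hi : IntegrableOn (layer ℓ n) (Ioo (-ℓ) ℓ) :=
    ((contDiff_layer ℓ n).continuous.integrableOn_Icc).mono_set Ioo_subset_Icc_self
  calc |∫ s in Ioo (-ℓ) ℓ, layer ℓ n s * G s| ≤ ∫ s in Ioo (-ℓ) ℓ, layer ℓ n s * M := by
        rw [← Real.norm_eq_abs]
        refine norm_integral_le_of_norm_le (hi.mul_const M) ?_
        filter_upwards [ae_restrict_mem measurableSet_Ioo] with s hs
        rw [norm_mul, Real.norm_of_nonneg (layer_nonneg ℓ n s)]
        exact mul_le_mul_of_nonneg_left (hM s hs) (layer_nonneg ℓ n s)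
    _ ≤ M := by
        rw [integral_mul_const, integral_layer hℓ]
        exact mul_le_of_le_one_left hM0 (Real.smoothTransition.le_one _)

end Layers

/-- Integrating a bounded function against a layer concentrating on one side of a region
parametrized by a rectangle recovers its trace on that side. -/
lemma tendsto_integral_mul_layer {Ω : Set Plane} {m ℓ : ℝ} (hℓ : 0 < ℓ) {T : ℝ × ℝ → Plane}
    (hT : MeasurePreserving T ((volume.restrict (Ioo (-m) m)).prod (volume.restrict (Ioo (-ℓ) ℓ)))
      (volume.restrict Ω)) {w : Plane → ℝ} {M : ℝ}
    (hw : AEStronglyMeasurable w (volume.restrict Ω)) (hM : ∀ x ∈ Ω, |w x| ≤ M)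
    (hTΩ : ∀ t ∈ Ioo (-m) m, ∀ s ∈ Ioo (-ℓ) ℓ, T (t, s) ∈ Ω) {c : ℝ}
    (hc : ∀ᵐ t ∂volume.restrict (Ioo (-m) m),
      Tendsto (fun s => w (T (t, s))) (𝓝[<] ℓ) (𝓝 c))
    {g : ℕ → Plane → ℝ} {b : ℕ → ℝ → ℝ} {b' : ℝ → ℝ} {K : ℝ}
    (hb : ∀ n, Continuous (b n)) (hbK : ∀ n, ∀ t ∈ Ioo (-m) m, |b n t| ≤ K)
    (hbb' : ∀ t ∈ Ioo (-m) m, Tendsto (fun n => b n t) atTop (𝓝 (b' t)))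
    (hgb : ∀ n t s, g n (T (t, s)) = b n t * layer ℓ n s)
    (hi : ∀ n, IntegrableOn (fun x => w x * g n x) Ω) :
    Tendsto (fun n => ∫ x in Ω, w x * g n x) atTop (𝓝 (∫ t in Ioo (-m) m, b' t * c)) := by
  have hG := hw.comp_measurePreserving hT
  have heq (n : ℕ) : ∫ x in Ω, w x * g n x = ∫ t in Ioo (-m) m, b n t *
      ∫ s in Ioo (-ℓ) ℓ, layer ℓ n s * w (T (t, s)) := by
    have h1 : Integrable (fun p => w (T p) * g n (T p))
        ((volume.restrict (Ioo (-m) m)).prod (volume.restrict (Ioo (-ℓ) ℓ))) :=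
      hT.integrable_comp_of_integrable (hi n)
    rw [← hT.map_eq, integral_map hT.measurable.aemeasurable
      (by rw [hT.map_eq]; exact (hi n).aestronglyMeasurable), integral_prod _ h1]
    congr with t
    rw [← integral_const_mul]
    congr with s
    rw [hgb]
    ring
  simp_rw [heq]
  refine tendsto_integral_of_dominated_convergence (fun _ => K * M) (fun n => ?_)
    (integrable_const _) (fun n => ?_) ?_
  · refine (hb n).aestronglyMeasurable.mul ?_
    have : AEStronglyMeasurable (fun p : ℝ × ℝ => layer ℓ n p.2 * w (T p))
        ((volume.restrict (Ioo (-m) m)).prod (volume.restrict (Ioo (-ℓ) ℓ))) :=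
      ((contDiff_layer ℓ n).continuous.comp continuous_snd).aestronglyMeasurable.mul hG
    exact this.integral_prod_right'
  · filter_upwards [ae_restrict_mem measurableSet_Ioo] with t ht
    rw [norm_mul]
    exact mul_le_mul (hbK n t ht)
      (abs_integral_layer_mul_le hℓ n fun s hs => hM _ (hTΩ t ht s hs)) (norm_nonneg _)
      ((abs_nonneg _).trans (hbK n t ht))
  · filter_upwards [ae_restrict_mem measurableSet_Ioo, hc, hG.prodMk_left] with t ht htc htm
    refine (hbb' t ht).mul (tendsto_integral_layer hℓ ?_ htc)
    refine Integrable.of_bound (C := M) htm ?_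
    filter_upwards [ae_restrict_mem measurableSet_Ioo] with s hs
    exact hM _ (hTΩ t ht s hs)

section Rectangle

abbrev rect (L : ℝ) : Set Plane := {x : Plane | |x 0| < L ∧ |x 1| < 1}

lemma isOpen_rect (L : ℝ) : IsOpen (rect L) := by
  have h (i : Fin 2) : Continuous fun x : Plane => |x i| := by fun_prop
  exact (isOpen_lt (h 0) continuous_const).inter (isOpen_lt (h 1) continuous_const)

lemma pt_mem_rect {L s t : ℝ} (hs : s ∈ Ioo (-L) L) (ht : t ∈ Ioo (-1) 1) : pt s t ∈ rect L :=
  ⟨abs_lt.2 hs, abs_lt.2 ht⟩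

lemma measurePreserving_pt : MeasurePreserving (fun p : ℝ × ℝ => pt p.1 p.2) :=
  (PiLp.volume_preserving_toLp (Fin 2)).comp (volume_preserving_finTwoArrow ℝ).symm

lemma measurePreserving_pt_rect (L : ℝ) :
    MeasurePreserving (fun p : ℝ × ℝ => pt p.1 p.2)
      ((volume.restrict (Ioo (-L) L)).prod (volume.restrict (Ioo (-1) 1)))
      (volume.restrict (rect L)) := by
  have h := measurePreserving_pt.restrict_preimage (isOpen_rect L).measurableSet
  have hpre : (fun p : ℝ × ℝ => pt p.1 p.2) ⁻¹' rect L = Ioo (-L) L ×ˢ Ioo (-1) 1 := by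
    ext p
    simp [pt, abs_lt]
  rwa [hpre, Measure.volume_eq_prod, ← Measure.prod_restrict] at h

lemma measurePreserving_pt_rect_swap (L : ℝ) :
    MeasurePreserving (fun p : ℝ × ℝ => pt p.2 p.1)
      ((volume.restrict (Ioo (-1) 1)).prod (volume.restrict (Ioo (-L) L)))
      (volume.restrict (rect L)) :=
  (measurePreserving_pt_rect L).comp Measure.measurePreserving_swap

lemma measurePreserving_prod_neg (m ℓ : ℝ) :
    MeasurePreserving (fun p : ℝ × ℝ => (p.1, -p.2))
      ((volume.restrict (Ioo (-m) m)).prod (volume.restrict (Ioo (-ℓ) ℓ)))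
      ((volume.restrict (Ioo (-m) m)).prod (volume.restrict (Ioo (-ℓ) ℓ))) := by
  have h := (Measure.measurePreserving_neg (volume : Measure ℝ)).restrict_preimage
    (measurableSet_Ioo (a := -ℓ) (b := ℓ))
  have hpre : (fun x : ℝ => -x) ⁻¹' Ioo (-ℓ) ℓ = Ioo (-ℓ) ℓ := by
    ext x
    simp [and_comm]
  rw [show (Neg.neg : ℝ → ℝ) ⁻¹' Ioo (-ℓ) ℓ = Ioo (-ℓ) ℓ from hpre] at h
  exact (MeasurePreserving.id _).prod h

variable {L M : ℝ} {w : Plane → ℝ}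

lemma integrableOn_rect_mul (hw : AEStronglyMeasurable w (volume.restrict (rect L)))
    (hM : ∀ x ∈ rect L, |w x| ≤ M) {g : Plane → ℝ} (hg : Continuous g) :
    IntegrableOn (fun x => w x * g x) (rect L) := by
  have hsub : rect L ⊆ closedBall 0 (L + 1) := fun x hx => by
    rw [mem_closedBall_zero_iff]
    calc ‖x‖ = ‖x 0 • e₀ + x 1 • e₁‖ := by rw [← eq_coord_combination]
      _ ≤ ‖x 0 • e₀‖ + ‖x 1 • e₁‖ := norm_add_le _ _
      _ ≤ L + 1 := by
        simp only [norm_smul, Real.norm_eq_abs]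
        simpa using add_le_add hx.1.le hx.2.le
  have hgi : IntegrableOn g (rect L) :=
    (hg.continuousOn.integrableOn_compact (isCompact_closedBall 0 (L + 1))).mono_set hsub
  exact hgi.bdd_mul (c := M) hw
    ((ae_restrict_mem (isOpen_rect L).measurableSet).mono fun x hx => hM x hx)

lemma tendsto_integral_mul_layer_right (hL : 0 < L)
    (hw : AEStronglyMeasurable w (volume.restrict (rect L))) (hM : ∀ x ∈ rect L, |w x| ≤ M) {c : ℝ}
    (hc : ∀ᵐ t ∂volume.restrict (Ioo (-1 : ℝ) 1),
      Tendsto (fun s => w (pt s t)) (𝓝[<] L) (𝓝 c))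
    {b : ℕ → ℝ → ℝ} (hb : ∀ n, Continuous (b n)) (hbK : ∀ n t, |b n t| ≤ 1)
    (hb1 : ∀ t ∈ Ioo (-1 : ℝ) 1, Tendsto (fun n => b n t) atTop (𝓝 1)) :
    Tendsto (fun n => ∫ x in rect L, w x * (b n (x 1) * layer L n (x 0))) atTop (𝓝 (2 * c)) := by
  have := tendsto_integral_mul_layer hL (measurePreserving_pt_rect_swap L) hw hM
    (fun t ht s hs => pt_mem_rect hs ht) hc (g := fun n x => b n (x 1) * layer L n (x 0)) hb
    (fun n t _ => hbK n t) hb1 (fun n t s => by simp [pt])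
    (fun n => integrableOn_rect_mul hw hM (by
      have := (contDiff_layer L n).continuous
      have := hb n
      fun_prop))
  simp only [one_mul, integral_const, MeasurableSet.univ, measureReal_restrict_apply, univ_inter,
    Real.volume_real_Ioo] at this
  convert this using 2
  norm_num

lemma tendsto_integral_mul_layer_left (hL : 0 < L)
    (hw : AEStronglyMeasurable w (volume.restrict (rect L))) (hM : ∀ x ∈ rect L, |w x| ≤ M)
    (hc : ∀ᵐ t ∂volume.restrict (Ioo (-1 : ℝ) 1),
      Tendsto (fun s => w (pt (-s) t)) (𝓝[<] L) (𝓝 0))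
    {b : ℕ → ℝ → ℝ} (hb : ∀ n, Continuous (b n)) (hbK : ∀ n t, |b n t| ≤ 1)
    (hb1 : ∀ t ∈ Ioo (-1 : ℝ) 1, Tendsto (fun n => b n t) atTop (𝓝 1)) :
    Tendsto (fun n => ∫ x in rect L, w x * (b n (x 1) * layer L n (-(x 0)))) atTop (𝓝 0) := by
  have := tendsto_integral_mul_layer hL
    ((measurePreserving_pt_rect_swap L).comp (measurePreserving_prod_neg 1 L)) hw hM
    (fun t ht s hs => pt_mem_rect (by simpa [neg_lt, and_comm] using hs) ht) hc
    (g := fun n x => b n (x 1) * layer L n (-(x 0))) hb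
    (fun n t _ => hbK n t) hb1 (fun n t s => by simp [pt])
    (fun n => integrableOn_rect_mul hw hM (by
      have := (contDiff_layer L n).continuous
      have := hb n
      fun_prop))
  simpa using this

lemma tendsto_integral_mul_layer_top
    (hw : AEStronglyMeasurable w (volume.restrict (rect L))) (hM : ∀ x ∈ rect L, |w x| ≤ M)
    (hc : ∀ᵐ t ∂volume.restrict (Ioo (-L) L),
      Tendsto (fun s => w (pt t s)) (𝓝[<] 1) (𝓝 0)) :
    Tendsto (fun n => ∫ x in rect L, w x * layer 1 n (x 1)) atTop (𝓝 0) := by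
  have := tendsto_integral_mul_layer one_pos (measurePreserving_pt_rect L) hw hM
    (fun t ht s hs => pt_mem_rect ht hs) hc (g := fun n x => layer 1 n (x 1))
    (b := fun _ _ => 1) (b' := fun _ => 1) (K := 1) (fun _ => continuous_const) (by simp)
    (by simp) (fun n t s => by simp [pt])
    (fun n => integrableOn_rect_mul hw hM (by
      have := (contDiff_layer 1 n).continuous
      fun_prop))
  simpa using this

lemma tendsto_integral_mul_layer_bottom
    (hw : AEStronglyMeasurable w (volume.restrict (rect L))) (hM : ∀ x ∈ rect L, |w x| ≤ M)
    (hc : ∀ᵐ t ∂volume.restrict (Ioo (-L) L),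
      Tendsto (fun s => w (pt t (-s))) (𝓝[<] 1) (𝓝 0)) :
    Tendsto (fun n => ∫ x in rect L, w x * layer 1 n (-(x 1))) atTop (𝓝 0) := by
  have := tendsto_integral_mul_layer one_pos
    ((measurePreserving_pt_rect L).comp (measurePreserving_prod_neg L 1)) hw hM
    (fun t ht s hs => pt_mem_rect ht (by simpa [neg_lt, and_comm] using hs)) hc
    (g := fun n x => layer 1 n (-(x 1)))
    (b := fun _ _ => 1) (b' := fun _ => 1) (K := 1) (fun _ => continuous_const) (by simp)
    (by simp) (fun n t s => by simp [pt])
    (fun n => integrableOn_rect_mul hw hM (by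
      have := (contDiff_layer 1 n).continuous
      fun_prop))
  simpa using this

lemma fderiv_mul_coord {α β : ℝ → ℝ} (hα : ContDiff ℝ 1 α) (hβ : ContDiff ℝ 1 β) (x v : Plane) :
    fderiv ℝ (fun x : Plane => α (x 0) * β (x 1)) x v =
      deriv α (x 0) * β (x 1) * v 0 + α (x 0) * deriv β (x 1) * v 1 := by
  have h0 : HasFDerivAt (fun x : Plane => α (x 0)) _ x :=
    ((hα.differentiable (by simp) (x 0)).hasDerivAt).comp_hasFDerivAt x
      (EuclideanSpace.proj (𝕜 := ℝ) (0 : Fin 2)).hasFDerivAt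
  have h1 : HasFDerivAt (fun x : Plane => β (x 1)) _ x :=
    ((hβ.differentiable (by simp) (x 1)).hasDerivAt).comp_hasFDerivAt x
      (EuclideanSpace.proj (𝕜 := ℝ) (1 : Fin 2)).hasFDerivAt
  rw [(h0.fun_mul h1).fderiv]
  simp
  ring

lemma contDiff_mul_coord {α β : ℝ → ℝ} (hα : ContDiff ℝ 1 α) (hβ : ContDiff ℝ 1 β) :
    ContDiff ℝ 1 fun x : Plane => α (x 0) * β (x 1) :=
  (hα.comp (by fun_prop)).mul (hβ.comp (by fun_prop))

lemma compact_support_of_coord_bounds {F : Plane → ℝ} {r ρ : ℝ} (hr : r < L) (hρ : ρ < 1)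
    (hF : ∀ x, F x ≠ 0 → |x 0| ≤ r ∧ |x 1| ≤ ρ) :
    HasCompactSupport F ∧ tsupport F ⊆ rect L := by
  have hcont (i : Fin 2) : Continuous fun x : Plane => |x i| := by fun_prop
  have hclosed : IsClosed {x : Plane | |x 0| ≤ r ∧ |x 1| ≤ ρ} :=
    (isClosed_le (hcont 0) continuous_const).inter (isClosed_le (hcont 1) continuous_const)
  have hsub : {x : Plane | |x 0| ≤ r ∧ |x 1| ≤ ρ} ⊆ closedBall 0 (r + ρ) := fun x hx => by
    rw [mem_closedBall_zero_iff]
    calc ‖x‖ = ‖x 0 • e₀ + x 1 • e₁‖ := by rw [← eq_coord_combination]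
      _ ≤ ‖x 0 • e₀‖ + ‖x 1 • e₁‖ := norm_add_le _ _
      _ ≤ r + ρ := by
        simp only [norm_smul, Real.norm_eq_abs]
        simpa using add_le_add hx.1 hx.2
  refine ⟨HasCompactSupport.intro ((isCompact_closedBall 0 (r + ρ)).of_isClosed_subset hclosed
    hsub) fun x hx => by_contra fun h => hx (hF x h), ?_⟩
  exact (closure_minimal (fun x hx => hF x hx) hclosed).trans
    fun x hx => ⟨hx.1.trans_lt hr, hx.2.trans_lt hρ⟩

/-- The product cutoff function on the rectangle. -/
def rectCutoff (L : ℝ) (n : ℕ) (x : Plane) : ℝ := cutoff L n (x 0) * cutoff 1 n (x 1)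

lemma contDiff_rectCutoff (L : ℝ) (n : ℕ) : ContDiff ℝ 1 (rectCutoff L n) :=
  contDiff_mul_coord (contDiff_cutoff L n) (contDiff_cutoff 1 n)

lemma rectCutoff_nonneg (L : ℝ) (n : ℕ) (x : Plane) : 0 ≤ rectCutoff L n x :=
  mul_nonneg (cutoff_nonneg _ _ _) (cutoff_nonneg _ _ _)

lemma rectCutoff_le_one (L : ℝ) (n : ℕ) (x : Plane) : rectCutoff L n x ≤ 1 :=
  mul_le_one₀ (cutoff_le_one _ _ _) (cutoff_nonneg _ _ _) (cutoff_le_one _ _ _)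

lemma rectCutoff_support (L : ℝ) {n : ℕ} (hn : 0 < n) :
    HasCompactSupport (rectCutoff L n) ∧ tsupport (rectCutoff L n) ⊆ rect L := by
  have hn' : (0 : ℝ) < 1 / n := by positivity
  exact compact_support_of_coord_bounds (r := L - 1 / n) (ρ := 1 - 1 / n) (by linarith)
    (by linarith) fun x hx => ⟨abs_le_of_cutoff_ne_zero hn (left_ne_zero_of_mul hx),
      abs_le_of_cutoff_ne_zero hn (right_ne_zero_of_mul hx)⟩

lemma fderiv_rectCutoff (hL : 1 < L) {n : ℕ} (hn : 2 ≤ n) (x v : Plane) :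
    fderiv ℝ (rectCutoff L n) x v =
      (layer L n (-(x 0)) - layer L n (x 0)) * cutoff 1 n (x 1) * v 0 +
        cutoff L n (x 0) * (layer 1 n (-(x 1)) - layer 1 n (x 1)) * v 1 := by
  have hn' : (2 : ℝ) ≤ n := by exact_mod_cast hn
  have := fderiv_mul_coord (contDiff_cutoff L n) (contDiff_cutoff 1 n) x v
  rwa [deriv_cutoff (by nlinarith), deriv_cutoff (by linarith)] at this

lemma fderiv_rectCutoff_le (hL : 1 < L) {n : ℕ} (hn : 2 ≤ n) (x v : Plane) (hv : ‖v‖ ≤ 1) :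
    fderiv ℝ (rectCutoff L n) x v ≤
      layer L n (x 0) + layer L n (-(x 0)) + (layer 1 n (x 1) + layer 1 n (-(x 1))) := by
  have aux {p q b y : ℝ} (hp : 0 ≤ p) (hq : 0 ≤ q) (hb0 : 0 ≤ b) (hb1 : b ≤ 1) (hy : |y| ≤ 1) :
      (q - p) * (b * y) ≤ p + q := by
    have h1 : |b * y| ≤ 1 := by
      rw [abs_mul, abs_of_nonneg hb0]
      exact mul_le_one₀ hb1 (abs_nonneg _) hy
    rw [abs_le] at h1
    nlinarith
  have hv' (i : Fin 2) : |v i| ≤ 1 := (PiLp.norm_apply_le v i).trans hv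
  rw [fderiv_rectCutoff hL hn]
  have h0 := aux (layer_nonneg L n (x 0)) (layer_nonneg L n (-(x 0))) (cutoff_nonneg 1 n (x 1))
    (cutoff_le_one 1 n (x 1)) (hv' 0)
  have h1 := aux (layer_nonneg 1 n (x 1)) (layer_nonneg 1 n (-(x 1))) (cutoff_nonneg L n (x 0))
    (cutoff_le_one L n (x 0)) (hv' 1)
  linarith

lemma eventually_rectCutoff_eq_one {K : Set Plane} (hK : IsCompact K) (hKL : K ⊆ rect L) :
    ∀ᶠ n in atTop, ∀ x ∈ K, rectCutoff L n x = 1 := by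
  obtain ⟨δ, hδ, hδL⟩ := hK.exists_cthickening_subset_open (isOpen_rect L) hKL
  have hmem {x v : Plane} (hx : x ∈ K) (hv : ‖v‖ ≤ δ) : x + v ∈ rect L :=
    hδL (mem_cthickening_of_dist_le _ x δ K hx (by simpa [dist_eq_norm] using hv))
  have hb {x : Plane} (hx : x ∈ K) : δ ≤ L - |x 0| ∧ δ ≤ 1 - |x 1| := by
    have h1 := hmem hx (v := δ • e₀) (by simp [norm_smul, abs_of_pos hδ])
    have h2 := hmem hx (v := (-δ) • e₀) (by simp [norm_smul, abs_of_pos hδ])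
    have h3 := hmem hx (v := δ • e₁) (by simp [norm_smul, abs_of_pos hδ])
    have h4 := hmem hx (v := (-δ) • e₁) (by simp [norm_smul, abs_of_pos hδ])
    simp [abs_lt] at h1 h2 h3 h4
    constructor
    · rcases abs_cases (x 0) with h | h <;> linarith
    · rcases abs_cases (x 1) with h | h <;> linarith
  filter_upwards [(tendsto_natCast_atTop_atTop.atTop_mul_const hδ).eventually_ge_atTop 2]
    with n hn x hx
  have h0 := mul_le_mul_of_nonneg_left (hb hx).1 (n.cast_nonneg (α := ℝ))
  have h1 := mul_le_mul_of_nonneg_left (hb hx).2 (n.cast_nonneg (α := ℝ))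
  rw [rectCutoff, cutoff_eq_one (hn.trans h0), cutoff_eq_one (hn.trans h1), one_mul]

end Rectangle

/-- `w` is bounded and measurable on the rectangle, with trace `c` on the right side and `0` on the
other three sides. -/
structure HasRightTrace (L c M : ℝ) (w : Plane → ℝ) : Prop where
  aestronglyMeasurable : AEStronglyMeasurable w (volume.restrict (rect L))
  abs_le : ∀ x ∈ rect L, |w x| ≤ M
  right : ∀ᵐ t ∂volume.restrict (Ioo (-1 : ℝ) 1), Tendsto (fun s => w (pt s t)) (𝓝[<] L) (𝓝 c)
  left : ∀ᵐ t ∂volume.restrict (Ioo (-1 : ℝ) 1), Tendsto (fun s => w (pt (-s) t)) (𝓝[<] L) (𝓝 0)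
  top : ∀ᵐ t ∂volume.restrict (Ioo (-L) L), Tendsto (fun s => w (pt t s)) (𝓝[<] 1) (𝓝 0)
  bottom : ∀ᵐ t ∂volume.restrict (Ioo (-L) L), Tendsto (fun s => w (pt t (-s))) (𝓝[<] 1) (𝓝 0)

/-- The sum of the layers at the four sides of the rectangle. -/
def rectLayer (L : ℝ) (n : ℕ) (x : Plane) : ℝ :=
  layer L n (x 0) + layer L n (-(x 0)) + (layer 1 n (x 1) + layer 1 n (-(x 1)))

section TraceLemmas

variable {L c M : ℝ} {w : Plane → ℝ}

lemma continuous_rectLayer (L : ℝ) (n : ℕ) : Continuous (rectLayer L n) := by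
  have h0 := (contDiff_layer L n).continuous
  have h1 := (contDiff_layer 1 n).continuous
  unfold rectLayer
  fun_prop

lemma HasRightTrace.tendsto_integral_rectLayer (hL : 0 < L) (h : HasRightTrace L c M w) :
    Tendsto (fun n => ∫ x in rect L, w x * rectLayer L n x) atTop (𝓝 (2 * c)) := by
  have hr := tendsto_integral_mul_layer_right hL h.1 h.2 h.right (b := fun _ _ => 1)
    (fun _ => continuous_const) (by simp) (by simp)
  have hl := tendsto_integral_mul_layer_left hL h.1 h.2 h.left (b := fun _ _ => 1)
    (fun _ => continuous_const) (by simp) (by simp)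
  have ht := tendsto_integral_mul_layer_top h.1 h.2 h.top
  have hb := tendsto_integral_mul_layer_bottom h.1 h.2 h.bottom
  simp only [one_mul] at hr hl
  have hsum := (hr.add hl).add (ht.add hb)
  rw [add_zero, add_zero, add_zero] at hsum
  refine hsum.congr fun n => ?_
  have h0 := (contDiff_layer L n).continuous
  have h1 := (contDiff_layer 1 n).continuous
  have i {g : Plane → ℝ} (hg : Continuous g) := integrableOn_rect_mul h.1 h.2 hg
  rw [← integral_add (i (by fun_prop)) (i (by fun_prop)),
    ← integral_add (i (by fun_prop)) (i (by fun_prop)), ← integral_add]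
  · simp only [rectLayer, mul_add]
  · exact (i (by fun_prop)).add (i (by fun_prop))
  · exact (i (by fun_prop)).add (i (by fun_prop))

/-- If the variation of `w` away from the boundary is controlled by the boundary layers, then the
total variation of `w` is at most the mass of its trace. -/
lemma HasRightTrace.integral_mul_divg_le (hL : 0 < L) (h : HasRightTrace L c M w)
    (hw : ∀ n ≥ 2, ∀ Ψ, IsTestField (rect L) Ψ → (∀ x, Ψ x ≠ 0 → rectCutoff L n x = 1) →
      ∫ x in rect L, w x * divg Ψ x ≤ ∫ x in rect L, w x * rectLayer L n x)
    {Ψ : Plane → Plane} (hΨ : IsTestField (rect L) Ψ) :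
    ∫ x in rect L, w x * divg Ψ x ≤ 2 * c := by
  refine ge_of_tendsto (h.tendsto_integral_rectLayer hL) ?_
  filter_upwards [eventually_ge_atTop 2,
    eventually_rectCutoff_eq_one hΨ.compact hΨ.tsupport_subset] with n hn hn1
  exact hw n hn Ψ hΨ fun x hx => hn1 x (subset_tsupport Ψ hx)

lemma divg_smul_const {g : Plane → ℝ} {x : Plane} (hg : DifferentiableAt ℝ g x) (e : Plane) :
    divg (fun y => g y • e) x = fderiv ℝ g x e := by
  rw [divg_smul hg (differentiableAt_const e)]
  simp [divg]

/-- If the total variation of `w` is at most the mass of its trace on the right side, then `w` has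
no variation in the vertical direction. -/
lemma HasRightTrace.integral_mul_fderiv_nonpos (hL : 1 < L) (h : HasRightTrace L c M w)
    (hw : ∀ Ψ, IsTestField (rect L) Ψ → ∫ x in rect L, w x * divg Ψ x ≤ 2 * c)
    {ζ : Plane → ℝ} (hζ : ContDiff ℝ 1 ζ) (hζc : HasCompactSupport ζ) (hζL : tsupport ζ ⊆ rect L) :
    ∫ x in rect L, w x * fderiv ℝ ζ x e₁ ≤ 0 := by
  have hL0 : 0 < L := by linarith
  set J := ∫ x in rect L, w x * fderiv ℝ ζ x e₁
  obtain ⟨Z, hZ⟩ := hζc.exists_bound_of_continuous hζ.continuous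
  have hζd := hζ.differentiable (by simp)
  have i {g : Plane → ℝ} (hg : Continuous g) := integrableOn_rect_mul h.1 h.2 hg
  have hle (ε : ℝ) : 2 * c + ε * J ≤ 2 * c * (1 + ε ^ 2 * Z ^ 2) := by
    set R := 1 + ε ^ 2 * Z ^ 2
    have hR1 : 1 ≤ R := by
      have : 0 ≤ ε ^ 2 * Z ^ 2 := by positivity
      linarith
    have hbound (n : ℕ) (hn : 2 ≤ n) :
        (∫ x in rect L, w x * (cutoff 1 n (x 1) * layer L n (x 0))) -
          (∫ x in rect L, w x * (cutoff 1 n (x 1) * layer L n (-(x 0)))) + ε * J ≤ 2 * c * R := by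
      have hη := contDiff_rectCutoff L n
      have hηd := hη.differentiable (by simp)
      obtain ⟨hηc, hηL⟩ := rectCutoff_support L (show 0 < n by omega)
      set Ψ : Plane → Plane := fun x =>
        (-(R⁻¹ * rectCutoff L n x)) • e₀ + (R⁻¹ * (ε * ζ x)) • e₁ with hΨ
      have hsupp : Function.support Ψ ⊆ tsupport (rectCutoff L n) ∪ tsupport ζ := by
        intro x hx
        by_contra hx'
        rw [mem_union, not_or] at hx'
        exact hx (by simp [hΨ, image_eq_zero_of_notMem_tsupport hx'.1,
          image_eq_zero_of_notMem_tsupport hx'.2])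
      have htest : IsTestField (rect L) Ψ := by
        refine ⟨?_, ?_, ?_, fun x => ?_⟩
        · exact ((contDiff_const.mul hη).neg.smul contDiff_const).add
            ((contDiff_const.mul (contDiff_const.mul hζ)).smul contDiff_const)
        · exact HasCompactSupport.of_support_subset_isCompact (hηc.union hζc) hsupp
        · exact (closure_minimal hsupp ((isClosed_tsupport _).union (isClosed_tsupport _))).trans
            (union_subset hηL hζL)
        · rw [← sq_le_one_iff₀ (norm_nonneg _), EuclideanSpace.norm_sq_eq, Fin.sum_univ_two]
          have h0 : rectCutoff L n x ^ 2 ≤ 1 :=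
            pow_le_one₀ (rectCutoff_nonneg L n x) (rectCutoff_le_one L n x)
          have h1 : ζ x ^ 2 ≤ Z ^ 2 := sq_le_sq' (neg_le_of_abs_le (hZ x)) (le_of_abs_le (hZ x))
          have h2 : rectCutoff L n x ^ 2 + ε ^ 2 * ζ x ^ 2 ≤ R :=
            add_le_add h0 (mul_le_mul_of_nonneg_left h1 (sq_nonneg ε))
          have h3 : R⁻¹ * R = 1 := inv_mul_cancel₀ (by linarith)
          have h4 : R⁻¹ ≤ 1 := inv_le_one_of_one_le₀ hR1
          have h5 : 0 ≤ R⁻¹ := by positivity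
          calc ‖Ψ x 0‖ ^ 2 + ‖Ψ x 1‖ ^ 2
              = R⁻¹ * (R⁻¹ * (rectCutoff L n x ^ 2 + ε ^ 2 * ζ x ^ 2)) := by
                rw [Real.norm_eq_abs, Real.norm_eq_abs, sq_abs, sq_abs]
                simp [hΨ]
                ring
            _ ≤ R⁻¹ * (R⁻¹ * R) := by gcongr
            _ ≤ 1 := by rw [h3, mul_one]; exact h4
      have hdiv (x : Plane) : w x * divg Ψ x = R⁻¹ * (w x * (cutoff 1 n (x 1) * layer L n (x 0)) -
          w x * (cutoff 1 n (x 1) * layer L n (-(x 0))) + ε * (w x * fderiv ℝ ζ x e₁)) := by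
        have d0 : DifferentiableAt ℝ (fun x => -(R⁻¹ * rectCutoff L n x)) x :=
          ((hηd x).const_mul _).fun_neg
        have d1 : DifferentiableAt ℝ (fun x => R⁻¹ * (ε * ζ x)) x :=
          ((hζd x).const_mul _).const_mul _
        have := divg_add (d0.smul_const e₀) (d1.smul_const e₁)
        rw [show Ψ = (fun x => (-(R⁻¹ * rectCutoff L n x)) • e₀) +
          fun x => (R⁻¹ * (ε * ζ x)) • e₁ from rfl, this, divg_smul_const d0, divg_smul_const d1,
          fderiv_fun_neg, fderiv_const_mul (hηd x), fderiv_const_mul ((hζd x).const_mul ε),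
          fderiv_const_mul (hζd x)]
        simp only [neg_apply, smul_apply, smul_eq_mul,
          fderiv_rectCutoff hL hn]
        simp
        ring
      have c0 := (contDiff_layer L n).continuous
      have c1 := (contDiff_cutoff 1 n).continuous
      have c2 : Continuous fun x => fderiv ℝ ζ x e₁ :=
        (hζ.continuous_fderiv (by simp)).clm_apply continuous_const
      have ir : IntegrableOn (fun x => w x * (cutoff 1 n (x 1) * layer L n (x 0))) (rect L) :=
        i (by fun_prop)
      have il : IntegrableOn (fun x => w x * (cutoff 1 n (x 1) * layer L n (-(x 0)))) (rect L) :=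
        i (by fun_prop)
      have hfin := hw Ψ htest
      simp_rw [hdiv] at hfin
      rw [integral_const_mul, integral_add (by exact ir.sub il) ((i c2).const_mul ε),
        integral_sub ir il, integral_const_mul] at hfin
      rwa [inv_mul_le_iff₀ (by linarith), mul_comm R] at hfin
    have hb1 (t : ℝ) (ht : t ∈ Ioo (-1 : ℝ) 1) : Tendsto (fun n => cutoff 1 n t) atTop (𝓝 1) :=
      tendsto_cutoff (abs_lt.2 ht)
    have hbK (n : ℕ) (t : ℝ) : |cutoff 1 n t| ≤ 1 := by
      rw [abs_of_nonneg (cutoff_nonneg _ _ _)]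
      exact cutoff_le_one _ _ _
    have hr := tendsto_integral_mul_layer_right hL0 h.1 h.2 h.right
      (fun n => (contDiff_cutoff 1 n).continuous) hbK hb1
    have hl := tendsto_integral_mul_layer_left hL0 h.1 h.2 h.left
      (fun n => (contDiff_cutoff 1 n).continuous) hbK hb1
    have := le_of_tendsto ((hr.sub hl).add_const (ε * J))
      ((eventually_ge_atTop 2).mono hbound)
    rwa [sub_zero] at this
  have hlim : Tendsto (fun ε : ℝ => 2 * c * Z ^ 2 * ε) (𝓝[>] 0) (𝓝 0) := by
    have : Continuous fun ε : ℝ => 2 * c * Z ^ 2 * ε := by fun_prop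
    simpa using (this.tendsto 0).mono_left nhdsWithin_le_nhds
  refine ge_of_tendsto hlim ?_
  filter_upwards [self_mem_nhdsWithin] with ε (hε : 0 < ε)
  refine le_of_mul_le_mul_left ?_ hε
  linarith [hle ε]

/-- A bounded function without vertical variation that vanishes on the horizontal sides vanishes. -/
lemma HasRightTrace.integral_mul_layer_nonpos (hL : 1 < L) (h : HasRightTrace L c M w)
    (hw : ∀ ζ : Plane → ℝ, ContDiff ℝ 1 ζ → HasCompactSupport ζ → tsupport ζ ⊆ rect L →
      ∫ x in rect L, w x * fderiv ℝ ζ x e₁ ≤ 0) {k : ℕ} (hk : 2 ≤ k) :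
    ∫ x in rect L, w x * layer L k (x 0) ≤ 0 := by
  have hk0 : (2 : ℝ) ≤ k := by exact_mod_cast hk
  have i {g : Plane → ℝ} (hg : Continuous g) := integrableOn_rect_mul h.1 h.2 hg
  have c0 := (contDiff_layer L k).continuous
  obtain ⟨B, hB⟩ : ∃ B, ∀ s ∈ Icc (-L) L, |layer L k s| ≤ B :=
    isCompact_Icc.exists_bound_of_continuousOn c0.continuousOn
  set w' : Plane → ℝ := fun x => w x * (x 1 * layer L k (x 0)) with hw'
  have hw'm : AEStronglyMeasurable w' (volume.restrict (rect L)) :=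
    h.1.mul (Continuous.aestronglyMeasurable (by fun_prop))
  have hw'M (x : Plane) (hx : x ∈ rect L) : |w' x| ≤ M * (1 * B) := by
    rw [hw', abs_mul, abs_mul]
    have h1 := h.2 x hx
    have h2 := hB (x 0) ⟨(abs_lt.1 hx.1).1.le, (abs_lt.1 hx.1).2.le⟩
    gcongr
    · exact (abs_nonneg _).trans h1
    · exact hx.2.le
  have htop := tendsto_integral_mul_layer_top hw'm hw'M <| by
    filter_upwards [h.top] with t ht
    have hc : Continuous fun s : ℝ => s * layer L k t := by fun_prop
    simpa [hw', pt] using ht.mul ((hc.tendsto 1).mono_left nhdsWithin_le_nhds)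
  have hbot := tendsto_integral_mul_layer_bottom hw'm hw'M <| by
    filter_upwards [h.bottom] with t ht
    have hc : Continuous fun s : ℝ => -s * layer L k t := by fun_prop
    simpa [hw', pt] using ht.mul ((hc.tendsto 1).mono_left nhdsWithin_le_nhds)
  have hmain : Tendsto (fun j => ∫ x in rect L, w x * (layer L k (x 0) * cutoff 1 j (x 1))) atTop
      (𝓝 (∫ x in rect L, w x * layer L k (x 0))) := by
    refine tendsto_integral_of_dominated_convergence (fun x => |w x * layer L k (x 0)|)
      (fun j => ?_) (i (by fun_prop)).abs (fun j => Eventually.of_forall fun x => ?_) ?_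
    · have := (contDiff_cutoff 1 j).continuous
      exact (i (by fun_prop)).aestronglyMeasurable
    · rw [← mul_assoc, norm_mul, Real.norm_eq_abs,
        Real.norm_of_nonneg (cutoff_nonneg _ _ _)]
      exact mul_le_of_le_one_right (abs_nonneg _) (cutoff_le_one _ _ _)
    · filter_upwards [ae_restrict_mem (isOpen_rect L).measurableSet] with x hx
      simpa using ((tendsto_cutoff hx.2).const_mul (layer L k (x 0))).const_mul (w x)
  have hlim := hmain.add (hbot.sub htop)
  rw [sub_zero, add_zero] at hlim
  refine le_of_tendsto hlim ?_
  filter_upwards [eventually_ge_atTop 2] with j hj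
  have hj0 : (2 : ℝ) ≤ j := by exact_mod_cast hj
  have hβ : ContDiff ℝ 1 fun s => s * cutoff 1 j s := contDiff_id.mul (contDiff_cutoff 1 j)
  have hβd (s : ℝ) : deriv (fun s => s * cutoff 1 j s) s =
      cutoff 1 j s + s * (layer 1 j (-s) - layer 1 j s) := by
    rw [deriv_fun_mul differentiableAt_fun_id
      ((contDiff_cutoff 1 j).differentiable (by simp) s), deriv_cutoff (by linarith)]
    simp
  obtain ⟨hζc, hζL⟩ := compact_support_of_coord_bounds (L := L) (r := L - 1 / k) (ρ := 1 - 1 / j)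
    (F := fun x => layer L k (x 0) * (x 1 * cutoff 1 j (x 1)))
    (by linarith [show (0 : ℝ) < 1 / k by positivity])
    (by linarith [show (0 : ℝ) < 1 / j by positivity]) fun x hx =>
      ⟨abs_le_of_layer_ne_zero (by omega) (by nlinarith) (left_ne_zero_of_mul hx),
        abs_le_of_cutoff_ne_zero (by omega) (right_ne_zero_of_mul (right_ne_zero_of_mul hx))⟩
  have := hw _ (contDiff_mul_coord (contDiff_layer L k) hβ) hζc hζL
  refine le_of_eq_of_le ?_ this
  have c1 := (contDiff_cutoff 1 j).continuous
  have c2 := (contDiff_layer 1 j).continuous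
  have iw {g : Plane → ℝ} (hg : Continuous g) := integrableOn_rect_mul hw'm hw'M hg
  rw [← integral_sub (iw (by fun_prop)) (iw (by fun_prop)), ← integral_add (i (by fun_prop))]
  · congr with x
    rw [fderiv_mul_coord (contDiff_layer L k) hβ, hβd]
    simp [hw']
    ring
  · exact (iw (by fun_prop)).sub (iw (by fun_prop))

/-- A nontrivial trace supported on the right side cannot be attained without variation beyond the
mass of the trace. -/
lemma HasRightTrace.nonpos (hL : 1 < L) (h : HasRightTrace L c M w)
    (hw : ∀ n ≥ 2, ∀ Ψ, IsTestField (rect L) Ψ → (∀ x, Ψ x ≠ 0 → rectCutoff L n x = 1) →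
      ∫ x in rect L, w x * divg Ψ x ≤ ∫ x in rect L, w x * rectLayer L n x) : c ≤ 0 := by
  have hL0 : 0 < L := by linarith
  have hr := tendsto_integral_mul_layer_right hL0 h.1 h.2 h.right (b := fun _ _ => 1)
    (fun _ => continuous_const) (by simp) (by simp)
  simp only [one_mul] at hr
  have := le_of_tendsto hr ((eventually_ge_atTop 2).mono fun k hk =>
    h.integral_mul_layer_nonpos hL (fun ζ hζ hζc hζL => h.integral_mul_fderiv_nonpos hL
      (fun Ψ hΨ => h.integral_mul_divg_le hL0 hw hΨ) hζ hζc hζL) hk)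
  linarith

end TraceLemmas

/-- A `C²` nondecreasing bounded truncation, vanishing below `p` and constant above `q`. -/
lemma exists_truncation {p q : ℝ} (hpq : p < q) : ∃ (f : ℝ → ℝ) (a : ℝ), 0 < a ∧ ContDiff ℝ 2 f ∧
    (∀ t, 0 ≤ deriv f t) ∧ (∀ t, deriv f t ≤ 1) ∧ (∀ t, 0 ≤ f t) ∧ (∀ t, f t ≤ a) ∧
    (∀ t ≤ p, f t = 0) ∧ f q = a := by
  obtain ⟨K, hK, hKle⟩ := exists_deriv_smoothTransition_le
  have hd : 0 < q - p := by linarith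
  have ha : 0 < (q - p) / K := by positivity
  have hderiv (t : ℝ) : deriv (fun t => (q - p) / K * Real.smoothTransition ((t - p) / (q - p))) t =
      deriv Real.smoothTransition ((t - p) / (q - p)) / K := by
    have h1 : HasDerivAt (fun t => Real.smoothTransition ((t - p) / (q - p)))
        (deriv Real.smoothTransition ((t - p) / (q - p)) * (1 / (q - p))) t :=
      (hasDerivAt_smoothTransition _).comp t (((hasDerivAt_id t).sub_const p).div_const (q - p))
    rw [(h1.const_mul _).deriv]
    field_simp
  refine ⟨fun t => (q - p) / K * Real.smoothTransition ((t - p) / (q - p)), (q - p) / K, ha,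
    contDiff_const.mul ((contDiff_smoothTransition 2).comp (by fun_prop)), fun t => ?_, fun t => ?_,
    fun t => ?_, fun t => ?_, fun t ht => ?_, ?_⟩
  · rw [hderiv]
    exact div_nonneg (deriv_smoothTransition_nonneg _) hK.le
  · rw [hderiv, div_le_one hK]
    exact hKle _
  · exact mul_nonneg ha.le (Real.smoothTransition.nonneg _)
  · exact mul_le_of_le_one_right ha.le (Real.smoothTransition.le_one _)
  · show _ * _ = _
    rw [Real.smoothTransition.zero_of_nonpos (div_nonpos_of_nonpos_of_nonneg (by linarith) hd.le),
      mul_zero]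
  · show _ * _ = _
    rw [div_self hd.ne', Real.smoothTransition.one, mul_one]

lemma tendsto_comp_neg_nhdsLT {g : ℝ → ℝ} {r : ℝ} {l : Filter ℝ} (h : Tendsto g (𝓝[>] (-r)) l) :
    Tendsto (fun s => g (-s)) (𝓝[<] r) l :=
  h.comp (tendsto_neg_nhdsLT (a := r))

/-- On the rectangle `Ω = (−L,L) × (−1,1)`, for the boundary datum `v_μ`
(equal to `x₁ + L` on the top side, `μ` on the right side and `0` on the other
two sides) with `μ > 2L`, there is no least gradient function with trace
`v_μ`. -/
theorem no_least_gradient_solution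
    (L mu : ℝ) (hL : 1 < L) (hmu : 2 * L < mu) :
    ¬ ∃ u : Plane → ℝ,
        LeastGradientOn u {x : Plane | |x 0| < L ∧ |x 1| < 1} ∧
        RectTrace L u
          (fun x : Plane =>
            if x 1 = 1 then x 0 + L else if x 0 = L then mu else 0) := by
  rintro ⟨u, hu, htr⟩
  obtain ⟨f, a, ha, hf, hf0, hf1, hfpos, hfa, hfL, hfmu⟩ := exists_truncation hmu
  have hL0 : 0 < L := by linarith
  have hfM (t : ℝ) : |f t| ≤ a := by
    rw [abs_of_nonneg (hfpos t)]
    exact hfa t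
  have hft (t : ℝ) : Tendsto f (𝓝 t) (𝓝 (f t)) := hf.continuous.tendsto t
  have hw : HasRightTrace L a a fun x => f (u x) := by
    refine ⟨hf.continuous.comp_aestronglyMeasurable hu.1.1.aestronglyMeasurable,
      fun x _ => hfM (u x), ?_, ?_, ?_, ?_⟩
    · filter_upwards [htr.1, ae_restrict_mem measurableSet_Ioo] with t ht htI
      have := (hft _).comp ht.1
      simpa [Function.comp_def, pt, htI.2.ne, hfmu] using this
    · filter_upwards [htr.1, ae_restrict_mem measurableSet_Ioo] with t ht htI
      have := tendsto_comp_neg_nhdsLT ((hft _).comp ht.2)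
      simpa [pt, htI.2.ne, show -L ≠ L by linarith, hfL 0 (by linarith)] using this
    · filter_upwards [htr.2, ae_restrict_mem measurableSet_Ioo] with t ht htI
      have := (hft _).comp ht.1
      simpa [Function.comp_def, pt, hfL (t + L) (by linarith [htI.2])] using this
    · filter_upwards [htr.2, ae_restrict_mem measurableSet_Ioo] with t ht htI
      have := tendsto_comp_neg_nhdsLT ((hft _).comp ht.2)
      simpa [pt, htI.2.ne, show (-1 : ℝ) ≠ 1 by norm_num, hfL 0 (by linarith)] using this
  refine absurd (hw.nonpos hL fun n hn Ψ hΨ hΨn => ?_) ha.not_ge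
  obtain ⟨hηc, hηL⟩ := rectCutoff_support L (show 0 < n by omega)
  have i {g : Plane → ℝ} (hg : Continuous g) := integrableOn_rect_mul hw.1 hw.2 hg
  exact hu.integral_mul_divg_le (isOpen_rect L) hf hf0 hf1 hfM hfpos
    (by simpa using i (continuous_const (y := 1))) (contDiff_rectCutoff L n) hηc hηL
    (rectCutoff_nonneg L n) (rectCutoff_le_one L n) (i (continuous_rectLayer L n))
    (fderiv_rectCutoff_le hL hn) hΨ hΨn
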